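/- arXiv:2009.12550 — 3 statements merged into one kernel-verified Lean document; each statement's English description precedes it below -/
import Mathlib

section
/- Let Q be a finite index set with |Q| ≥ 1, let r ≥ 0 be a real number, let x̄ ∈ [0,1]^Q and ȳ_1 ≥ 0, and let d ∈ Q maximize x̄_q over q ∈ Q. Consider the linear program max{Σ_{q∈Q} x̄_q α_q − ȳ_1 − γ : −r − γ ≤ 0, Σ_{q∈Q\{q'}} α_q − (r+1) − γ ≤ 0 for all q' ∈ Q, 0 ≤ α_q ≤ 1 for all q ∈ Q} in variables (α, γ). Then: (a) if |Q| ≤ 2, the point (e, −r) (e the all-ones vector of ℝ^Q) is an optimal solution; (b) if |Q| ≥ 3, setting s = (Σ_{q∈Q} x̄_q)/(|Q|−1), the point (e^d, −r) is an optimal solution when s ≤ x̄_d, the point ((1/(|Q|−1))·e, −r) is an optimal solution when x̄_d < s ≤ 1, and the point (e, −r + |Q| − 2) is an optimal solution when s > 1. -/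
open scoped BigOperators

/-- Feasibility for the linear program of Lemma 4: `−r − γ ≤ 0`,
`Σ_{q ≠ q'} α_q − (r+1) − γ ≤ 0` for all `q'`, and `0 ≤ α_q ≤ 1`. -/
def lpFeas {Q : Type*} [Fintype Q] [DecidableEq Q] (r : ℝ) (α : Q → ℝ) (γ : ℝ) :
    Prop :=
  -r - γ ≤ 0 ∧
  (∀ q' : Q, (∑ q ∈ Finset.univ.erase q', α q) - (r + 1) - γ ≤ 0) ∧
  ∀ q, 0 ≤ α q ∧ α q ≤ 1

/-- `(α, γ)` is an optimal solution of the linear program of Lemma 4 with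
objective `Σ_q x̄_q α_q − ȳ_1 − γ`. -/
def lpOpt {Q : Type*} [Fintype Q] [DecidableEq Q] (r : ℝ) (xb : Q → ℝ) (yb1 : ℝ)
    (α : Q → ℝ) (γ : ℝ) : Prop :=
  lpFeas r α γ ∧
  ∀ (α' : Q → ℝ) (γ' : ℝ), lpFeas r α' γ' →
    ∑ q, xb q * α' q - yb1 - γ' ≤ ∑ q, xb q * α q - yb1 - γ

/-- Nonnegative multipliers `w` of the constraints indexed by `q'` combine them into one. -/
lemma lpFeas.sum_weighted_le {Q : Type*} [Fintype Q] [DecidableEq Q] {r γ : ℝ} {α : Q → ℝ}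
    (h : lpFeas r α γ) (w : Q → ℝ) (hw : ∀ q, 0 ≤ w q) :
    ∑ q, (∑ p, w p - w q) * α q ≤ (∑ q, w q) * (1 + r + γ) := by
  have hle : ∑ q, w q * (∑ p, α p - α q) ≤ ∑ q, w q * (1 + r + γ) := by
    refine Finset.sum_le_sum fun q _ => mul_le_mul_of_nonneg_left ?_ (hw q)
    have hq := h.2.1 q
    rw [Finset.sum_erase_eq_sub (Finset.mem_univ q)] at hq
    linarith
  rw [← Finset.sum_mul] at hle
  refine le_of_eq_of_le ?_ hle
  simp only [sub_mul, mul_sub, Finset.sum_sub_distrib, ← Finset.mul_sum, ← Finset.sum_mul]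

/-- Multipliers `w` with total at most one bound the objective when the combined constraint
dominates it coefficientwise. -/
lemma lpFeas.sum_mul_sub_le {Q : Type*} [Fintype Q] [DecidableEq Q] {r γ : ℝ} {α : Q → ℝ}
    (h : lpFeas r α γ) (x w : Q → ℝ) (hw : ∀ q, 0 ≤ w q) (hw1 : ∑ q, w q ≤ 1)
    (hx : ∀ q, x q ≤ ∑ p, w p - w q) :
    ∑ q, x q * α q - γ ≤ ∑ q, w q + r := by
  have hle : ∑ q, x q * α q ≤ ∑ q, (∑ p, w p - w q) * α q :=
    Finset.sum_le_sum fun q _ => mul_le_mul_of_nonneg_right (hx q) (h.2.2 q).1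
  have hsum := h.sum_weighted_le w hw
  have hγ := h.1
  nlinarith

/-- Lemma 4: (a) if `|Q| ≤ 2` then `(e, −r)` is optimal;
(b) if `|Q| ≥ 3` then, with `s = (Σ_q x̄_q)/(|Q|−1)`, the point `(e^d, −r)` is
optimal when `s ≤ x̄_d`, the point `((1/(|Q|−1)) e, −r)` is optimal when
`x̄_d < s ≤ 1`, and the point `(e, −r + |Q| − 2)` is optimal when `s > 1`. -/
theorem lp_erase_constraints_opt {Q : Type*} [Fintype Q] [DecidableEq Q]
    (hQ : 1 ≤ Fintype.card Q)
    (r : ℝ) (hr : 0 ≤ r)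
    (xb : Q → ℝ) (hx : ∀ q, 0 ≤ xb q ∧ xb q ≤ 1)
    (yb1 : ℝ) (hy : 0 ≤ yb1)
    (d : Q) (hd : ∀ q, xb q ≤ xb d) :
    (Fintype.card Q ≤ 2 → lpOpt r xb yb1 (fun _ => (1 : ℝ)) (-r)) ∧
    (3 ≤ Fintype.card Q →
      ((∑ q, xb q) / ((Fintype.card Q : ℝ) - 1) ≤ xb d →
        lpOpt r xb yb1 (Pi.single d (1 : ℝ)) (-r)) ∧
      (xb d < (∑ q, xb q) / ((Fintype.card Q : ℝ) - 1) →
        (∑ q, xb q) / ((Fintype.card Q : ℝ) - 1) ≤ 1 →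
        lpOpt r xb yb1 (fun _ => 1 / ((Fintype.card Q : ℝ) - 1)) (-r)) ∧
      (1 < (∑ q, xb q) / ((Fintype.card Q : ℝ) - 1) →
        lpOpt r xb yb1 (fun _ => (1 : ℝ)) (-r + (Fintype.card Q : ℝ) - 2))) := by
  have hsum_erase (c : ℝ) (q : Q) :
      ∑ _p ∈ Finset.univ.erase q, c = ((Fintype.card Q : ℝ) - 1) * c := by
    rw [Finset.sum_erase_eq_sub (Finset.mem_univ q)]
    simp
    ring
  refine ⟨fun hcard => ?_, fun hcard => ?_⟩
  · have hn : (Fintype.card Q : ℝ) ≤ 2 := by exact_mod_cast hcard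
    refine ⟨⟨by simp, fun q => ?_, fun q => by simp⟩, fun α γ h => ?_⟩
    · rw [hsum_erase]
      linarith
    · have hle : ∑ q, xb q * α q ≤ ∑ q, xb q * 1 :=
        Finset.sum_le_sum fun q _ => mul_le_mul_of_nonneg_left (h.2.2 q).2 (hx q).1
      linarith [h.1]
  have hn : (3 : ℝ) ≤ Fintype.card Q := by exact_mod_cast hcard
  have hpos : (0 : ℝ) < (Fintype.card Q : ℝ) - 1 := by linarith
  refine ⟨fun hs => ?_, fun hds hs => ?_, fun hs => ?_⟩
  · rw [div_le_iff₀ hpos] at hs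
    refine ⟨⟨by simp, fun q => ?_, fun q => ?_⟩, fun α γ h => ?_⟩
    · have hle : ∑ p ∈ Finset.univ.erase q, (Pi.single d (1 : ℝ) : Q → ℝ) p ≤ 1 := by
        rw [Finset.sum_pi_single']
        split_ifs <;> norm_num
      linarith
    · rw [Pi.single_apply]
      split_ifs <;> norm_num
    · have hd0 := (hx d).1
      set D : ℝ := ∑ q, (xb d - xb q) with hD
      have hDge : xb d ≤ D := by
        simp only [hD, Finset.sum_sub_distrib, Finset.sum_const, Finset.card_univ,
          nsmul_eq_mul]
        linarith
      have hD0 : 0 ≤ D := hd0.trans hDge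
      have hwsum : ∑ q, xb d / D * (xb d - xb q) = xb d := by
        rw [← Finset.mul_sum, ← hD]
        exact div_mul_cancel_of_imp fun h0 => le_antisymm (h0 ▸ hDge) hd0
      have key := h.sum_mul_sub_le xb (fun q => xb d / D * (xb d - xb q))
        (fun q => mul_nonneg (div_nonneg hd0 hD0) (sub_nonneg.2 (hd q)))
        (by rw [hwsum]; exact (hx d).2)
        (fun q => by
          rw [hwsum]
          linarith [mul_le_of_le_one_left (sub_nonneg.2 (hd q)) (div_le_one_of_le₀ hDge hD0)])
      rw [hwsum] at key
      have hobj : ∑ q, xb q * (Pi.single d (1 : ℝ) : Q → ℝ) q = xb d := by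
        simp [Pi.single_apply]
      rw [hobj]
      linarith
  · set s : ℝ := (∑ q, xb q) / ((Fintype.card Q : ℝ) - 1) with hsdef
    have hS : ∑ q, xb q = s * ((Fintype.card Q : ℝ) - 1) := (div_mul_cancel₀ _ hpos.ne').symm
    refine ⟨⟨by simp, fun q => ?_, fun q => ⟨by positivity, ?_⟩⟩, fun α γ h => ?_⟩
    · rw [hsum_erase, mul_one_div_cancel hpos.ne']
      linarith
    · rw [div_le_one hpos]
      linarith
    · have hwsum : ∑ q, (s - xb q) = s := by
        simp only [Finset.sum_sub_distrib, Finset.sum_const, Finset.card_univ, nsmul_eq_mul, hS]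
        ring
      have key := h.sum_mul_sub_le xb (fun q => s - xb q)
        (fun q => by linarith [hd q]) (by rw [hwsum]; exact hs)
        (fun q => by rw [hwsum]; linarith)
      rw [hwsum] at key
      rw [← Finset.sum_mul, mul_one_div, ← hsdef]
      linarith
  · rw [one_lt_div hpos] at hs
    refine ⟨⟨by linarith, fun q => ?_, fun q => by simp⟩, fun α γ h => ?_⟩
    · rw [hsum_erase]
      linarith
    · set c : ℝ := (1 - Fintype.card Q + ∑ q, xb q) / Fintype.card Q with hc
      have hc0 : 0 ≤ c := div_nonneg (by linarith) (by linarith)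
      have hcn : (Fintype.card Q : ℝ) * c = 1 - Fintype.card Q + ∑ q, xb q :=
        mul_div_cancel₀ _ (by linarith)
      have hwsum : ∑ q, (1 - xb q + c) = 1 := by
        simp only [Finset.sum_add_distrib, Finset.sum_sub_distrib, Finset.sum_const,
          Finset.card_univ, nsmul_eq_mul, hcn]
        ring
      have key := h.sum_weighted_le (fun q => 1 - xb q + c)
        (fun q => by linarith [(hx q).2])
      rw [hwsum] at key
      have hle : ∑ q, c * α q ≤ ∑ _q : Q, c :=
        Finset.sum_le_sum fun q _ => mul_le_of_le_one_right hc0 (h.2.2 q).2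
      rw [Finset.sum_const, Finset.card_univ, nsmul_eq_mul, hcn] at hle
      have hsplit : ∑ q, xb q * α q =
          ∑ q, (1 - (1 - xb q + c)) * α q + ∑ q, c * α q := by
        rw [← Finset.sum_add_distrib]
        exact Finset.sum_congr rfl fun q _ => by ring
      simp only [mul_one]
      linarith
end

section
/- If a point (x̄, ȳ) ∈ [0,1]^Q × ℝ_{≥0}^T satisfies Σ_{q∈Q} a_q ⌈x̄_q⌉ ≤ Σ_{t∈T} b_t ⌊ȳ_t⌋ + c, then (x̄, ȳ) ∈ P. -/
open scoped BigOperators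

/-- The unsplittable flow arc-set `X`. -/
def ufX {Q T : Type*} [Fintype Q] [Fintype T] (a : Q → ℝ) (b : T → ℝ) (c : ℝ) :
    Set ((Q → ℝ) × (T → ℝ)) :=
  {p | (∀ q, p.1 q = 0 ∨ p.1 q = 1) ∧ (∀ t, ∃ n : ℕ, p.2 t = n) ∧
    ∑ q, a q * p.1 q ≤ ∑ t, b t * p.2 t + c}

/-- The unsplittable flow arc-set polyhedron `P = conv(X)`. -/
noncomputable def ufP {Q T : Type*} [Fintype Q] [Fintype T]
    (a : Q → ℝ) (b : T → ℝ) (c : ℝ) : Set ((Q → ℝ) × (T → ℝ)) :=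
  convexHull ℝ (ufX a b c)

/-- if `(x̄, ȳ) ∈ [0,1]^Q × ℝ_{≥0}^T` satisfies
`Σ_q a_q ⌈x̄_q⌉ ≤ Σ_t b_t ⌊ȳ_t⌋ + c`, then `(x̄, ȳ) ∈ P`. -/
theorem round_in_P {Q T : Type*} [Fintype Q] [Fintype T]
    (a : Q → ℝ) (b : T → ℝ) (c : ℝ) (t1 : T)
    (ha : ∀ q, 0 < a q) (hb : ∀ t, 0 < b t) (hb1 : ∀ t, b t1 ≤ b t)
    (hc : 0 < ∑ q, a q - c)
    (xb : Q → ℝ) (yb : T → ℝ)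
    (hx : ∀ q, 0 ≤ xb q ∧ xb q ≤ 1) (hy : ∀ t, 0 ≤ yb t)
    (h : ∑ q, a q * ((⌈xb q⌉ : ℤ) : ℝ) ≤ ∑ t, b t * ((⌊yb t⌋ : ℤ) : ℝ) + c) :
    (xb, yb) ∈ ufP a b c := by
  set S : Set (Q → ℝ) := Set.univ.pi fun q => {0, (⌈xb q⌉ : ℝ)}
  set U : Set (T → ℝ) := Set.univ.pi fun t => {(⌊yb t⌋ : ℝ), (⌊yb t⌋ : ℝ) + 1}
  have hsub : S ×ˢ U ⊆ ufX a b c := by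
    rintro ⟨x, y⟩ ⟨hxS, hyU⟩
    have hxS : ∀ q, x q = 0 ∨ x q = (⌈xb q⌉ : ℝ) := fun q => by simpa using hxS q trivial
    have hyU : ∀ t, y t = (⌊yb t⌋ : ℝ) ∨ y t = (⌊yb t⌋ : ℝ) + 1 := fun t => by
      simpa using hyU t trivial
    refine ⟨fun q => ?_, fun t => ?_, ?_⟩
    · have h0 : 0 ≤ ⌈xb q⌉ := Int.ceil_nonneg (hx q).1
      have h1 : ⌈xb q⌉ ≤ 1 := Int.ceil_le.2 (by simpa using (hx q).2)
      have h01 : ⌈xb q⌉ = 0 ∨ ⌈xb q⌉ = 1 := by omega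
      rcases hxS q with hq | hq
      · exact Or.inl hq
      · rcases h01 with h | h <;> simp [hq, h]
    · obtain ⟨n, hn⟩ := Int.eq_ofNat_of_zero_le (Int.floor_nonneg.2 (hy t))
      rcases hyU t with ht | ht
      · exact ⟨n, by simp [ht, hn]⟩
      · exact ⟨n + 1, by simp [ht, hn]⟩
    · have hle : ∑ q, a q * x q ≤ ∑ q, a q * (⌈xb q⌉ : ℝ) := by
        refine Finset.sum_le_sum fun q _ => mul_le_mul_of_nonneg_left ?_ (ha q).le
        have h0 : (0 : ℝ) ≤ ⌈xb q⌉ := by exact_mod_cast Int.ceil_nonneg (hx q).1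
        rcases hxS q with hq | hq <;> linarith
      have hge : ∑ t, b t * (⌊yb t⌋ : ℝ) ≤ ∑ t, b t * y t := by
        refine Finset.sum_le_sum fun t _ => mul_le_mul_of_nonneg_left ?_ (hb t).le
        rcases hyU t with ht | ht <;> linarith
      change ∑ q, a q * x q ≤ ∑ t, b t * y t + c
      linarith
  refine convexHull_mono hsub ?_
  rw [convexHull_prod, convexHull_pi, convexHull_pi]
  refine ⟨fun q _ => ?_, fun t _ => ?_⟩
  · beta_reduce
    rw [convexHull_pair, segment_eq_Icc ((hx q).1.trans (Int.le_ceil _))]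
    exact ⟨(hx q).1, Int.le_ceil _⟩
  · beta_reduce
    rw [convexHull_pair, segment_eq_Icc (by linarith)]
    exact ⟨Int.floor_le _, (Int.lt_floor_add_one _).le⟩
end

section
/- Suppose T = {1}, Q ≠ ∅, a_q ≤ b_1 and b_1·r + c < a_q for all q ∈ Q, and Σ_{q∈Q} a_q ≤ b_1(r + 1) + c. Then the polyhedron P admits the complete linear description P = {(x, y_1) ∈ [0,1]^Q × ℝ : Σ_{q∈Q} a_q x_q ≤ b_1 y_1 + c, and x_q ≤ y_1 − r for all q ∈ Q}. -/
open scoped BigOperators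

/-- Every real number above a natural number `m` is a convex combination of natural numbers
above `m`. -/
lemma mem_convexHull_natCast_of_le {m : ℕ} {w : ℝ} (hw : (m : ℝ) ≤ w) :
    w ∈ convexHull ℝ {v : ℝ | ∃ n : ℕ, v = n ∧ m ≤ n} := by
  have hw0 : 0 ≤ w := (Nat.cast_nonneg m).trans hw
  have hfloor : m ≤ ⌊w⌋₊ := Nat.le_floor hw
  have hsub := segment_subset_convexHull (𝕜 := ℝ)
    (s := {v : ℝ | ∃ n : ℕ, v = n ∧ m ≤ n}) (x := (⌊w⌋₊ : ℝ)) (y := ((⌊w⌋₊ + 1 : ℕ) : ℝ))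
    ⟨_, rfl, hfloor⟩ ⟨_, rfl, hfloor.trans (Nat.le_succ _)⟩
  apply hsub
  rw [segment_eq_Icc (by simp)]
  exact ⟨Nat.floor_le hw0, by push_cast; exact (Nat.lt_floor_add_one w).le⟩

/-- If every 0-1 vector is feasible at all integral capacities at least `m`, then so is, up to
convexification, every vector of the unit cube at all real capacities at least `m`. -/
lemma mem_ufP_of_cube {Q T : Type*} [Fintype Q] [Fintype T] {a : Q → ℝ} {b : T → ℝ} {c : ℝ}
    {m : ℕ} (ha : ∀ q, 0 ≤ a q) (hb : ∀ t, 0 ≤ b t)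
    (hm : ∑ q, a q ≤ ∑ t, b t * m + c)
    {x : Q → ℝ} {y : T → ℝ} (hx : ∀ q, 0 ≤ x q ∧ x q ≤ 1) (hy : ∀ t, (m : ℝ) ≤ y t) :
    (x, y) ∈ ufP a b c := by
  have hsub : (Set.univ.pi fun _ : Q => ({0, 1} : Set ℝ)) ×ˢ
      (Set.univ.pi fun _ : T => {v : ℝ | ∃ n : ℕ, v = n ∧ m ≤ n}) ⊆ ufX a b c := by
    rintro ⟨u, v⟩ ⟨hu, hv⟩
    have hu' : ∀ q, u q = 0 ∨ u q = 1 := fun q => hu q trivial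
    have hv' : ∀ t, ∃ n : ℕ, v t = n ∧ m ≤ n := fun t => hv t trivial
    refine ⟨hu', fun t => (hv' t).imp fun n hn => hn.1, ?_⟩
    have hleft : ∑ q, a q * u q ≤ ∑ q, a q := by
      refine Finset.sum_le_sum fun q _ => mul_le_of_le_one_right (ha q) ?_
      rcases hu' q with h | h <;> simp [h]
    have hright : ∑ t, b t * (m : ℝ) ≤ ∑ t, b t * v t := by
      refine Finset.sum_le_sum fun t _ => mul_le_mul_of_nonneg_left ?_ (hb t)
      obtain ⟨n, hn, hmn⟩ := hv' t
      rw [hn]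
      exact_mod_cast hmn
    dsimp only
    linarith
  refine convexHull_mono hsub ?_
  rw [convexHull_prod, convexHull_pi, convexHull_pi]
  refine ⟨fun q _ => ?_, fun t _ => mem_convexHull_natCast_of_le (hy t)⟩
  rw [convexHull_pair, segment_eq_Icc zero_le_one]
  exact hx q

/-- under the single-facility assumptions of Proposition 5, the
polyhedron `P` admits the complete linear description
`P = {(x, y) ∈ [0,1]^Q × ℝ : Σ_q a_q x_q ≤ b_1 y_1 + c and x_q ≤ y_1 − r
for all q}`. -/
theorem single_facility_complete_description {Q T : Type*} [Fintype Q] [Fintype T]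
    [Nonempty Q]
    (a : Q → ℝ) (b : T → ℝ) (c : ℝ) (t1 : T) (hT : ∀ t : T, t = t1)
    (ha : ∀ q, 0 < a q) (hb : ∀ t, 0 < b t) (hb1 : ∀ t, b t1 ≤ b t)
    (hc : 0 < ∑ q, a q - c)
    (r : ℝ) (hr : r = max ((⌈-c / b t1⌉ : ℤ) : ℝ) 0)
    (h1 : ∀ q, a q ≤ b t1) (h2 : ∀ q, b t1 * r + c < a q)
    (h3 : ∑ q, a q ≤ b t1 * (r + 1) + c) :
    ufP a b c = {p : (Q → ℝ) × (T → ℝ) |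
      (∀ q, 0 ≤ p.1 q ∧ p.1 q ≤ 1) ∧
      ∑ q, a q * p.1 q ≤ b t1 * p.2 t1 + c ∧
      ∀ q, p.1 q ≤ p.2 t1 - r} := by
  have hbpos := hb t1
  have hsum : ∀ f : T → ℝ, ∑ t, f t = f t1 := fun f =>
    Fintype.sum_eq_single t1 fun t ht => absurd (hT t) ht
  obtain ⟨m, hm⟩ : ∃ m : ℕ, r = m := by
    refine ⟨⌈-c / b t1⌉.toNat, ?_⟩
    rw [hr, ← Int.cast_natCast, Int.toNat_eq_max]
    push_cast
    rfl
  have hr0 : 0 ≤ b t1 * r + c := by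
    have h : -c / b t1 ≤ r := (Int.le_ceil _).trans (hr ▸ le_max_left _ _)
    rw [div_le_iff₀ hbpos] at h
    linarith
  have hcube : ∀ {x : Q → ℝ} {y : T → ℝ}, (∀ q, 0 ≤ x q ∧ x q ≤ 1) → r + 1 ≤ y t1 →
      (x, y) ∈ ufP a b c := by
    intro x y hx hy
    refine mem_ufP_of_cube (m := m + 1) (fun q => (ha q).le) (fun t => (hb t).le) ?_ hx ?_
    · rw [hsum]
      push_cast
      rwa [← hm]
    · intro t
      rw [hT t]
      push_cast
      rwa [← hm]
  apply Set.Subset.antisymm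
  · refine convexHull_min ?_ ?_
    · rintro ⟨x, y⟩ ⟨hx, hy, hxy⟩
      dsimp only at hx hy hxy
      rw [hsum] at hxy
      have hx0 : ∀ q, 0 ≤ x q := fun q => by rcases hx q with h | h <;> simp [h]
      refine ⟨fun q => ⟨hx0 q, by rcases hx q with h | h <;> simp [h]⟩, hxy, fun q => ?_⟩
      obtain ⟨n, hn⟩ := hy t1
      dsimp only
      rcases hx q with h | h
      · have hload : 0 ≤ ∑ q, a q * x q :=
          Finset.sum_nonneg fun q _ => mul_nonneg (ha q).le (hx0 q)
        have hceil : ⌈-c / b t1⌉ ≤ (n : ℤ) := by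
          rw [Int.ceil_le, div_le_iff₀ hbpos, Int.cast_natCast, ← hn]
          linarith
        have hrn : r ≤ n := by
          rw [hr]
          exact max_le (by exact_mod_cast hceil) (Nat.cast_nonneg n)
        rw [h, hn]
        linarith
      · have hload : a q * x q ≤ ∑ q, a q * x q :=
          Finset.single_le_sum (f := fun q => a q * x q)
            (fun q _ => mul_nonneg (ha q).le (hx0 q)) (Finset.mem_univ q)
        have hlt : r < y t1 := by
          refine lt_of_mul_lt_mul_left ?_ hbpos.le
          rw [h] at hload
          linarith [h2 q]
        rw [h, hn, hm]
        rw [hn, hm] at hlt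
        have hle : (m : ℝ) + 1 ≤ n := by exact_mod_cast hlt
        linarith
    · rintro ⟨x, y⟩ ⟨hx, hxy, hxr⟩ ⟨x', y'⟩ ⟨hx', hxy', hxr'⟩ α β hα hβ hαβ
      dsimp only at hx hxy hxr hx' hxy' hxr'
      refine ⟨fun q => ⟨?_, ?_⟩, ?_, fun q => ?_⟩
      · exact add_nonneg (mul_nonneg hα (hx q).1) (mul_nonneg hβ (hx' q).1)
      · have := mul_le_mul_of_nonneg_left (hx q).2 hα
        have := mul_le_mul_of_nonneg_left (hx' q).2 hβ
        change α * x q + β * x' q ≤ 1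
        linarith
      · have hlin : ∑ q, a q * (α * x q + β * x' q) =
            α * ∑ q, a q * x q + β * ∑ q, a q * x' q := by
          rw [Finset.mul_sum, Finset.mul_sum, ← Finset.sum_add_distrib]
          exact Finset.sum_congr rfl fun q _ => by ring
        change ∑ q, a q * (α * x q + β * x' q) ≤ b t1 * (α * y t1 + β * y' t1) + c
        rw [hlin]
        calc α * ∑ q, a q * x q + β * ∑ q, a q * x' q
            ≤ α * (b t1 * y t1 + c) + β * (b t1 * y' t1 + c) := by gcongr
          _ = b t1 * (α * y t1 + β * y' t1) + (α + β) * c := by ring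
          _ = b t1 * (α * y t1 + β * y' t1) + c := by rw [hαβ, one_mul]
      · change α * x q + β * x' q ≤ α * y t1 + β * y' t1 - r
        calc α * x q + β * x' q ≤ α * (y t1 - r) + β * (y' t1 - r) := by
              gcongr
              exacts [hxr q, hxr' q]
          _ = α * y t1 + β * y' t1 - (α + β) * r := by ring
          _ = α * y t1 + β * y' t1 - r := by rw [hαβ, one_mul]
  · rintro ⟨x, y⟩ ⟨hx, -, hxr⟩
    dsimp only at hx hxr
    have hbase : ((0 : Q → ℝ), fun _ : T => r) ∈ ufP a b c := by
      refine subset_convexHull ℝ _ ⟨fun q => Or.inl rfl, fun t => ⟨m, hm⟩, ?_⟩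
      simpa [hsum] using hr0
    obtain ⟨q₀⟩ := ‹Nonempty Q›
    have hz0 : 0 ≤ y t1 - r := (hx q₀).1.trans (hxr q₀)
    rcases le_or_gt 1 (y t1 - r) with hz1 | hz1
    · exact hcube hx (by linarith)
    rcases hz0.eq_or_lt with hz | hz
    · have hx0 : x = 0 := funext fun q => le_antisymm ((hxr q).trans_eq hz.symm) (hx q).1
      have hyr : y = fun _ => r := funext fun t => by rw [hT t]; linarith
      rwa [hx0, hyr]
    · have htop : ((fun q => x q / (y t1 - r)), fun _ : T => r + 1) ∈ ufP a b c :=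
        hcube (fun q => ⟨div_nonneg (hx q).1 hz.le, (div_le_one hz).2 (hxr q)⟩) le_rfl
      have hcomb := convex_convexHull ℝ (ufX a b c) htop hbase hz.le
        (sub_nonneg.2 hz1.le) (add_sub_cancel _ _)
      refine (congrArg (· ∈ ufP a b c) (Prod.ext ?_ ?_)).mpr hcomb
      · funext q
        change x q = (y t1 - r) * (x q / (y t1 - r)) + (1 - (y t1 - r)) * 0
        rw [mul_div_cancel₀ _ hz.ne', mul_zero, add_zero]
      · funext t
        change y t = (y t1 - r) * (r + 1) + (1 - (y t1 - r)) * r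
        rw [hT t]
        ring
end
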